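/- arXiv:2203.01991 — 2 statements merged into one kernel-verified Lean document; each statement's English description precedes it below -/
import Mathlib

section
/- Let (R,m,k) be a Noetherian local ring, let M be a nonzero finitely generated R-module with g = grade(M), and let N be an R-module. Then Ext_R^i(M,N) ≅ Tor_{g-i}^R(E_R(M), N) for all i with 0 ≤ i ≤ g−1. -/
open CategoryTheory IsLocalRing

universe u

/-- `extMod S n A B` is the `n`-th Ext module `Ext_S^n(A, B)` of `S`-modules `A` and `B`,
realized as an object of `ModuleCat S`. -/
noncomputable def extMod (S : Type u) [CommRing S] (n : ℕ)
    (A : Type u) [AddCommGroup A] [Module S A] (B : Type u) [AddCommGroup B] [Module S B] :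
    ModuleCat.{u} S :=
  ((Ext S (ModuleCat.{u} S) n).obj (Opposite.op (ModuleCat.of S A))).obj (ModuleCat.of S B)

/-- `torMod S n A B` is the `n`-th Tor module `Tor^S_n(A, B)`. -/
noncomputable def torMod (S : Type u) [CommRing S] (n : ℕ)
    (A : Type u) [AddCommGroup A] [Module S A] (B : Type u) [AddCommGroup B] [Module S B] :
    ModuleCat.{u} S :=
  ((Tor (ModuleCat.{u} S) n).obj (ModuleCat.of S A)).obj (ModuleCat.of S B)

/-- `moduleGrade S M = inf { n | Ext_S^n(M, S) ≠ 0 }`. -/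
noncomputable def moduleGrade (S : Type u) [CommRing S]
    (M : Type u) [AddCommGroup M] [Module S M] : ℕ :=
  sInf {n : ℕ | ¬ Subsingleton (extMod S n M S)}

/-- A minimal free resolution `⋯ → F₁ → F₀ → M → 0` of a module `M` over a local ring
`(R, m)`: each `Fₙ` is finite free, the complex is exact (a resolution of `M`), and each
differential maps into `m • Fₙ` (minimality). -/
structure MinimalFreeResolution (R : Type u) [CommRing R] [IsLocalRing R]
    (M : Type u) [AddCommGroup M] [Module R M] : Type (u + 1) where
  F : ℕ → Type u
  [acg : ∀ n, AddCommGroup (F n)]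
  [mod : ∀ n, Module R (F n)]
  free : ∀ n, Module.Free R (F n)
  finite : ∀ n, Module.Finite R (F n)
  /-- the differential `∂_{n+1} : F_{n+1} → F_n` -/
  d : ∀ n, F (n + 1) →ₗ[R] F n
  /-- the augmentation `F₀ → M` -/
  aug : F 0 →ₗ[R] M
  aug_surjective : Function.Surjective aug
  exact_at_zero : LinearMap.range (d 0) = LinearMap.ker aug
  exact : ∀ n, LinearMap.range (d (n + 1)) = LinearMap.ker (d n)
  minimal : ∀ n, LinearMap.range (d n) ≤ (maximalIdeal R) • (⊤ : Submodule R (F n))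

attribute [instance] MinimalFreeResolution.acg MinimalFreeResolution.mod

variable {R : Type u} [CommRing R] [IsLocalRing R]
  {M : Type u} [AddCommGroup M] [Module R M]

/-- The image of the dualized differential `∂_g^* : F_{g-1}^* → F_g^*`
(interpreted as `⊥ ⊆ F₀^*` when `g = 0`, since `F_{-1} = 0`). -/
noncomputable def codual (res : MinimalFreeResolution R M) :
    ∀ g : ℕ, Submodule R (Module.Dual R (res.F g))
  | 0 => ⊥
  | g' + 1 => LinearMap.range (res.d g').dualMap

/-- `E_R(M) = coker ( ∂_g^* : F_{g-1}^* → F_g^* )`, where `g = grade M` and `F_•` is a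
minimal free resolution of `M`. -/
noncomputable abbrev ERes (res : MinimalFreeResolution R M) (g : ℕ) : Type u :=
  Module.Dual R (res.F g) ⧸ codual res g

open Limits MonoidalCategory

section Tor

variable {R : Type u} [CommRing R]

/-- The functor `X ↦ X ⊗ P_•`, where `P_•` is the chosen projective resolution of `N`. -/
noncomputable abbrev tensorResolution (N : ModuleCat.{u} R) :
    ModuleCat.{u} R ⥤ ChainComplex (ModuleCat.{u} R) ℕ where
  obj X := (((tensoringLeft (ModuleCat.{u} R)).obj X).mapHomologicalComplex _).obj
      (projectiveResolution N).complex
  map f := (NatTrans.mapHomologicalComplex ((tensoringLeft (ModuleCat.{u} R)).map f) _).app _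
  map_id X := by ext; simp
  map_comp f g := by ext; simp

instance (N : ModuleCat.{u} R) : (tensorResolution N).PreservesZeroMorphisms where
  map_zero X Y := by
    ext i : 1
    exact congr_app ((tensoringLeft (ModuleCat.{u} R)).map_zero X Y) _

lemma tensorResolution_map_shortExact (N : ModuleCat.{u} R) {S : ShortComplex (ModuleCat.{u} R)}
    (hS : S.ShortExact) : (S.map (tensorResolution N)).ShortExact := by
  apply HomologicalComplex.shortExact_of_degreewise_shortExact
  intro i
  have : Module.Projective R ((projectiveResolution N).complex.X i) :=
    (IsProjective.iff_projective _).2 ((projectiveResolution N).projective i)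
  exact hS.map_of_exact (tensorRight ((projectiveResolution N).complex.X i))

lemma isZero_homology_tensorResolution (N P : ModuleCat.{u} R) [Module.Flat R P] (n : ℕ) :
    IsZero (((tensorResolution N).obj P).homology (n + 1)) := by
  rw [← HomologicalComplex.exactAt_iff_isZero_homology,
    HomologicalComplex.exactAt_iff' _ (n + 2) (n + 1) n (by simp) (by simp)]
  exact ((projectiveResolution N).exact_succ n).map (tensorLeft P)

lemma tensorResolution_homology_iso_Tor (N X : ModuleCat.{u} R) (n : ℕ) :
    Nonempty (((Tor (ModuleCat.{u} R) n).obj X).obj N ≅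
      ((tensorResolution N).obj X).homology n) :=
  ⟨(projectiveResolution N).isoLeftDerivedObj _ n⟩

lemma Tor_iso_of_shortExact (N : ModuleCat.{u} R) {S : ShortComplex (ModuleCat.{u} R)}
    (hS : S.ShortExact) [Module.Flat R S.X₂] (n : ℕ) :
    Nonempty (((Tor (ModuleCat.{u} R) (n + 2)).obj S.X₃).obj N ≅
      ((Tor (ModuleCat.{u} R) (n + 1)).obj S.X₁).obj N) := by
  obtain ⟨e₁⟩ := tensorResolution_homology_iso_Tor N S.X₃ (n + 2)
  obtain ⟨e₂⟩ := tensorResolution_homology_iso_Tor N S.X₁ (n + 1)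
  exact ⟨e₁ ≪≫ (tensorResolution_map_shortExact N hS).δIso (n + 2) (n + 1) (by simp)
    (isZero_homology_tensorResolution N S.X₂ (n + 1))
    (isZero_homology_tensorResolution N S.X₂ n) ≪≫ e₂.symm⟩

lemma tensorResolution_homology_zero_iso (N : ModuleCat.{u} R) {X Y : ModuleCat.{u} R}
    (f : X ⟶ Y) : Nonempty (Arrow.mk (HomologicalComplex.homologyMap
      ((tensorResolution N).map f) 0) ≅ Arrow.mk (f ▷ N)) := by
  let P := projectiveResolution N
  let e (X : ModuleCat.{u} R) := (ChainComplex.isoHomologyι₀ ((tensorResolution N).obj X)) ≪≫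
    asIso (P.fromLeftDerivedZero' ((tensoringLeft (ModuleCat.{u} R)).obj X))
  refine ⟨Arrow.isoMk (e X) (e Y) ?_⟩
  have h : HomologicalComplex.opcyclesMap ((tensorResolution N).map f) 0 ≫
      P.fromLeftDerivedZero' ((tensoringLeft (ModuleCat.{u} R)).obj Y) =
      P.fromLeftDerivedZero' ((tensoringLeft (ModuleCat.{u} R)).obj X) ≫ f ▷ N := by
    rw [← cancel_epi (HomologicalComplex.pOpcycles _ _),
      HomologicalComplex.p_opcyclesMap_assoc]
    erw [P.pOpcycles_comp_fromLeftDerivedZero', P.pOpcycles_comp_fromLeftDerivedZero'_assoc]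
    exact (whisker_exchange f (P.π.f 0)).symm
  simp [e, h]

lemma Tor_one_iso_of_shortExact (N : ModuleCat.{u} R) {S : ShortComplex (ModuleCat.{u} R)}
    (hS : S.ShortExact) [Module.Flat R S.X₂] :
    Nonempty (((Tor (ModuleCat.{u} R) 1).obj S.X₃).obj N ≅ kernel (S.f ▷ N)) := by
  obtain ⟨e₁⟩ := tensorResolution_homology_iso_Tor N S.X₃ 1
  have hT := tensorResolution_map_shortExact N hS
  have := hT.mono_δ 1 0 rfl (isZero_homology_tensorResolution N S.X₂ 0)
  obtain ⟨e₂⟩ := tensorResolution_homology_zero_iso N S.f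
  refine ⟨e₁ ≪≫ ?_⟩
  have h := (hT.homology_exact₁ 1 0 rfl).fIsKernel
  exact KernelFork.mapIsoOfIsLimit h (limit.isLimit _) e₂

end Tor

namespace MinimalFreeResolution
variable (res : MinimalFreeResolution R M)

lemma d_comp_d (n : ℕ) : res.d n ∘ₗ res.d (n + 1) = 0 :=
  LinearMap.range_le_ker_iff.1 (res.exact n).le

lemma aug_comp_d : res.aug ∘ₗ res.d 0 = 0 :=
  LinearMap.range_le_ker_iff.1 res.exact_at_zero.le

/-- The chain complex `⋯ → F₁ → F₀` underlying a minimal free resolution. -/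
noncomputable def complex : ChainComplex (ModuleCat.{u} R) ℕ :=
  ChainComplex.of (fun n => ModuleCat.of R (res.F n)) (fun n => ModuleCat.ofHom (res.d n))
    (fun n => ModuleCat.hom_ext (res.d_comp_d n))

@[simp]
lemma complex_d (n : ℕ) : res.complex.d (n + 1) n = ModuleCat.ofHom (res.d n) :=
  ChainComplex.of_d (fun n => ModuleCat.of R (res.F n)) (fun n => ModuleCat.ofHom (res.d n)) n

/-- A minimal free resolution, viewed as a projective resolution. -/
noncomputable def projectiveResolution : ProjectiveResolution (ModuleCat.of R M) where
  complex := res.complex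
  projective n := by
    have := res.free n
    exact (IsProjective.iff_projective (res.F n)).1 inferInstance
  π := (ChainComplex.toSingle₀Equiv _ _).symm ⟨ModuleCat.ofHom res.aug, by
    rw [complex_d]
    exact ModuleCat.hom_ext res.aug_comp_d⟩
  quasiIso := ⟨fun n => by
    cases n with
    | zero =>
      rw [ChainComplex.quasiIsoAt₀_iff, ShortComplex.quasiIso_iff_of_zeros']
      · refine (ShortComplex.exact_and_epi_g_iff_of_iso (S₂ :=
          ShortComplex.mk (ModuleCat.ofHom (res.d 0)) (ModuleCat.ofHom res.aug)
            (ModuleCat.hom_ext res.aug_comp_d)) ?_).2 ⟨?_, ?_⟩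
        · exact ShortComplex.isoMk (Iso.refl _) (Iso.refl _) (Iso.refl _) (by simp; rfl)
            (by simp; rfl)
        · exact (ShortComplex.moduleCat_exact_iff_range_eq_ker _).2 res.exact_at_zero
        · exact (ModuleCat.epi_iff_surjective _).2 res.aug_surjective
      all_goals rfl
    | succ n =>
      rw [quasiIsoAt_iff_exactAt' _ _ (ChainComplex.exactAt_succ_single_obj _ _),
        HomologicalComplex.exactAt_iff' _ (n + 2) (n + 1) n (by simp) (by simp),
        ShortComplex.moduleCat_exact_iff_range_eq_ker]
      change LinearMap.range (res.complex.d (n + 2) (n + 1)).hom =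
        LinearMap.ker (res.complex.d (n + 1) n).hom
      simpa only [complex_d] using! res.exact n⟩

variable (N : Type u) [AddCommGroup N] [Module R N]

/-- The image of `Hom(F_{n-1}, N) → Hom(F_n, N)`, interpreted as `⊥` for `n = 0`. -/
noncomputable def coboundaries : ∀ n : ℕ, Submodule R (res.F n →ₗ[R] N)
  | 0 => ⊥
  | n + 1 => LinearMap.range ((res.d n).lcomp R N)

lemma coboundaries_le_ker (n : ℕ) :
    res.coboundaries N n ≤ LinearMap.ker ((res.d n).lcomp R N) := by
  cases n with
  | zero => exact bot_le
  | succ n =>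
    rintro _ ⟨f, rfl⟩
    have : (f ∘ₗ res.d n) ∘ₗ res.d (n + 1) = 0 := by
      rw [LinearMap.comp_assoc, res.d_comp_d, LinearMap.comp_zero]
    exact this

/-- The map `Hom(F_n, N) / im Hom(F_{n-1}, N) → Hom(F_{n+1}, N)` induced by `∂_{n+1}`. -/
noncomputable def fromCoboundaryQuotient (n : ℕ) :
    ((res.F n →ₗ[R] N) ⧸ res.coboundaries N n) →ₗ[R] (res.F (n + 1) →ₗ[R] N) :=
  (res.coboundaries N n).liftQ ((res.d n).lcomp R N) (res.coboundaries_le_ker N n)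

lemma extMod_iso (n : ℕ) :
    Nonempty (extMod R n M N ≅ kernel (ModuleCat.ofHom (res.fromCoboundaryQuotient N n))) := by
  let K := res.projectiveResolution.complex.linearYonedaObj R (ModuleCat.of R N)
  have e : extMod R n M N ≅ K.homology n := res.projectiveResolution.isoExt n _
  let φ (n : ℕ) : K.X n ≃ₗ[R] (res.F n →ₗ[R] N) :=
    ModuleCat.homLinearEquiv (M := ModuleCat.of R (res.F n)) (N := ModuleCat.of R N)
  have hd (n : ℕ) (x : K.X n) : φ (n + 1) (K.d n (n + 1) x) = (φ n x) ∘ₗ res.d n := by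
    change (res.complex.d (n + 1) n ≫ x).hom = _
    rw [complex_d]
    rfl
  have hq : (LinearMap.range (K.sc n).f.hom).map (φ n).toLinearMap = res.coboundaries N n := by
    change (LinearMap.range (K.d ((ComplexShape.up ℕ).prev n) n).hom).map (φ n).toLinearMap = _
    cases n with
    | zero =>
      rw [K.shape _ _ (by simp)]
      simp [coboundaries]
    | succ n =>
      rw [CochainComplex.prev_nat_succ, ← LinearMap.range_comp, coboundaries,
        ← LinearMap.range_comp_of_range_eq_top ((res.d n).lcomp R N) (LinearEquiv.range (φ n))]
      congr 1
      ext x : 1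
      exact hd n x
  let q : K.opcycles n ≅ ModuleCat.of R ((res.F n →ₗ[R] N) ⧸ res.coboundaries N n) :=
    (K.sc n).moduleCatOpcyclesIso ≪≫ (Submodule.Quotient.equiv _ _ (φ n) hq).toModuleIso
  have hp : K.pOpcycles n ≫ q.hom =
      ModuleCat.ofHom ((res.coboundaries N n).mkQ ∘ₗ (φ n).toLinearMap) := by
    change (K.sc n).pOpcycles ≫ _ ≫ _ = _
    rw [ShortComplex.pOpcycles_comp_moduleCatOpcyclesIso_hom_assoc]
    rfl
  have hq' : q.hom ≫ ModuleCat.ofHom (res.fromCoboundaryQuotient N n) =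
      K.fromOpcycles n (n + 1) ≫ (φ (n + 1)).toModuleIso.hom := by
    rw [← cancel_epi (K.pOpcycles n), reassoc_of% hp, K.p_fromOpcycles_assoc]
    ext x : 2
    exact (hd n x).symm
  exact ⟨e ≪≫ KernelFork.mapIsoOfIsLimit (K.homologyIsKernel n (n + 1) (by simp))
    (limit.isLimit _) (Arrow.isoMk q (φ (n + 1)).toModuleIso hq')⟩

/-- The sequence `0 → coker ∂_n^* → F_{n+1}^* → coker ∂_{n+1}^* → 0`, which is exact except
possibly on the left. -/
noncomputable def dualShortComplex (n : ℕ) : ShortComplex (ModuleCat.{u} R) :=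
  ShortComplex.moduleCatMk (res.fromCoboundaryQuotient R n) (res.coboundaries R (n + 1)).mkQ (by
    rw [← LinearMap.range_le_ker_iff, Submodule.ker_mkQ]
    exact (Submodule.range_liftQ _ _ _).le)

lemma dualShortComplex_shortExact {n : ℕ} (h : Subsingleton (extMod R n M R)) :
    (res.dualShortComplex n).ShortExact where
  exact := (ShortComplex.moduleCat_exact_iff_range_eq_ker _).2
    ((Submodule.range_liftQ _ _ _).trans (Submodule.ker_mkQ _).symm)
  mono_f := by
    obtain ⟨e⟩ := res.extMod_iso R n
    exact Preadditive.mono_of_isZero_kernel _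
      ((ModuleCat.isZero_of_subsingleton (extMod R n M R)).of_iso e.symm)
  epi_g := (ModuleCat.epi_iff_surjective _).2 (Submodule.mkQ_surjective _)

instance (n : ℕ) : Module.Flat R (res.dualShortComplex n).X₂ := by
  have := res.free (n + 1)
  have := res.finite (n + 1)
  exact inferInstanceAs (Module.Flat R (Module.Dual R (res.F (n + 1))))

/-- `coker ∂_n^* ⊗ N` is the cokernel of `Hom(F_{n-1}, N) → Hom(F_n, N)`. -/
lemma coboundaryQuotient_tensor_iso (n : ℕ) :
    Nonempty (Arrow.mk ((res.dualShortComplex n).f ▷ ModuleCat.of R N) ≅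
      Arrow.mk (ModuleCat.ofHom (res.fromCoboundaryQuotient N n))) := by
  have := res.free
  have := res.finite
  let φ (n : ℕ) := dualTensorHomEquiv R (res.F n) N
  have hq : (LinearMap.range (TensorProduct.map (res.coboundaries R n).subtype
      (LinearMap.id : N →ₗ[R] N))).map (φ n).toLinearMap = res.coboundaries N n := by
    change ((res.coboundaries R n).subtype.rTensor N).range.map _ = _
    cases n with
    | zero =>
      have h : (res.coboundaries R 0).subtype = 0 := by
        ext ⟨x, hx⟩ : 1
        exact hx
      rw [h, LinearMap.rTensor_zero, LinearMap.range_zero, Submodule.map_bot, coboundaries]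
    | succ n =>
      have h : (φ (n + 1)).toLinearMap ∘ₗ (res.d n).dualMap.rTensor N =
          (res.d n).lcomp R N ∘ₗ (φ n).toLinearMap :=
        dualTensorHom_comp_rTensor_dualMap (res.d n)
      rw [coboundaries, ← LinearMap.rTensor_range, ← LinearMap.range_comp, coboundaries,
        ← LinearMap.range_comp_of_range_eq_top ((res.d n).lcomp R N) (LinearEquiv.range (φ n)),
        ← h]
      rfl
  let q := (TensorProduct.quotientTensorEquiv N (res.coboundaries R n)).trans
    (Submodule.Quotient.equiv _ _ (φ n) hq)
  have hq' : res.fromCoboundaryQuotient N n ∘ₗ q.toLinearMap =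
      (φ (n + 1)).toLinearMap ∘ₗ (res.fromCoboundaryQuotient R n).rTensor N := by
    ext f x y
    simp [q, φ, fromCoboundaryQuotient]
  let e₁ : (res.dualShortComplex n).X₁ ⊗ ModuleCat.of R N ≅
      ModuleCat.of R ((res.F n →ₗ[R] N) ⧸ res.coboundaries N n) := q.toModuleIso
  let e₂ : (res.dualShortComplex n).X₂ ⊗ ModuleCat.of R N ≅
      ModuleCat.of R (res.F (n + 1) →ₗ[R] N) := (φ (n + 1)).toModuleIso
  have he : e₁.hom ≫ ModuleCat.ofHom (res.fromCoboundaryQuotient N n) =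
      (res.dualShortComplex n).f ▷ ModuleCat.of R N ≫ e₂.hom := ModuleCat.hom_ext hq'
  exact ⟨Arrow.isoMk e₁ e₂ he⟩

lemma tor_dualShortComplex_iso {i : ℕ} (k : ℕ)
    (h : ∀ j < i + 1 + k, Subsingleton (extMod R j M R)) :
    Nonempty (torMod R (k + 1) ((res.F (i + 1 + k) →ₗ[R] R) ⧸ res.coboundaries R (i + 1 + k)) N ≅
      extMod R i M N) := by
  induction k with
  | zero =>
    obtain ⟨e₁⟩ := Tor_one_iso_of_shortExact (ModuleCat.of R N)
      (res.dualShortComplex_shortExact (h i (by lia)))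
    obtain ⟨e₂⟩ := res.coboundaryQuotient_tensor_iso N i
    obtain ⟨e₃⟩ := res.extMod_iso N i
    exact ⟨e₁ ≪≫ KernelFork.mapIsoOfIsLimit (limit.isLimit _) (limit.isLimit _) e₂ ≪≫ e₃.symm⟩
  | succ k ih =>
    obtain ⟨e₁⟩ := Tor_iso_of_shortExact (ModuleCat.of R N)
      (res.dualShortComplex_shortExact (h (i + 1 + k) (by lia))) k
    obtain ⟨e₂⟩ := ih (fun j hj => h j (by lia))
    exact ⟨e₁ ≪≫ e₂⟩

end MinimalFreeResolution

/-- For a nonzero finitely generated module `M` with `g = grade M` over a Noetherian local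
ring `R`, and any `R`-module `N`, `Ext_R^i(M, N) ≅ Tor_{g-i}^R(E_R(M), N)` for
`0 ≤ i ≤ g - 1`. -/
theorem ext_iso_tor_of_minimalFreeResolution [IsNoetherianRing R]
    [Module.Finite R M] (hM : Nontrivial M)
    (res : MinimalFreeResolution R M)
    (N : Type u) [AddCommGroup N] [Module R N] :
    ∀ i : ℕ, i + 1 ≤ moduleGrade R M →
      Nonempty (extMod R i M N ≅
        torMod R (moduleGrade R M - i) (ERes res (moduleGrade R M)) N) := by
  intro i hi
  obtain ⟨k, hk⟩ := Nat.exists_eq_add_of_le hi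
  have h : ∀ j < i + 1 + k, Subsingleton (extMod R j M R) := fun j hj =>
    not_not.1 (Nat.notMem_of_lt_sInf (hk ▸ hj :))
  obtain ⟨e⟩ := res.tor_dualShortComplex_iso N k h
  rw [hk, show i + 1 + k - i = k + 1 by lia,
    show i + 1 + k = i + k + 1 by lia]
  rw [show i + 1 + k = i + k + 1 by lia] at e
  exact ⟨e.symm⟩
end

section
/- Let k be a field, let Q = k[[x,y,z]] be the formal power series ring in three variables, and let M = Q/(x², xy, xz). Then pd_Q(M) = 3, Ext_Q^2(M,Q) = 0, and Ext_Q^1(M,Q) ≠ 0. In particular, M is a finitely generated module of finite projective dimension over the regular local ring Q with grade(M) = 1 < pd_Q(M), Ext_Q^2(M,Q) = 0, and Ext_Q^1(M,Q) ≠ 0, so the conclusion 'Ext_Q^n(M,N) = 0 for some n ≤ pd_Q(M) implies Ext_Q^i(M,N) = 0 for i ≤ n' fails when the Cohen–Macaulay hypothesis on M is dropped. -/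
open CategoryTheory IsLocalRing

universe u

/-- The projective dimension of `M` over `R`, characterized by vanishing of `Ext`:
`pd_R M = inf { n | Ext_R^i(M, N) = 0 for all i > n and all modules N }` in `ℕ∞`. -/
noncomputable def projDim (R : Type u) [CommRing R]
    (M : Type u) [AddCommGroup M] [Module R M] : ℕ∞ :=
  sInf {n : ℕ∞ | ∀ i : ℕ, n < (i : ℕ∞) → ∀ N : ModuleCat.{u} R,
    Subsingleton (((Ext R (ModuleCat.{u} R) i).obj (Opposite.op (ModuleCat.of R M))).obj N)}

/-- The ideal `(x², xy, xz)` of `Q = k[[x, y, z]]`, where `x = X 0`, `y = X 1`, `z = X 2`. -/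
noncomputable def exIdeal (k : Type u) [Field k] : Ideal (MvPowerSeries (Fin 3) k) :=
  Ideal.span {MvPowerSeries.X 0 ^ 2,
    MvPowerSeries.X 0 * MvPowerSeries.X 1,
    MvPowerSeries.X 0 * MvPowerSeries.X 2}

open Limits

section KoszulType

variable (S : Type u) [CommRing S]

/-- The linear form `(a, b, c) ↦ a u + b v + c w`. -/
def linForm (u v w : S) : S × S × S →ₗ[S] S where
  toFun p := p.1 * u + p.2.1 * v + p.2.2 * w
  map_add' p q := by simp only [Prod.fst_add, Prod.snd_add]; ring
  map_smul' r p := by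
    simp only [Prod.smul_fst, Prod.smul_snd, smul_eq_mul, RingHom.id_apply]; ring

lemma linForm_apply (u v w a b c : S) :
    linForm S u v w (a, b, c) = a * u + b * v + c * w := rfl

lemma exists_eq_linForm (f : S × S × S →ₗ[S] S) : ∃ u v w, f = linForm S u v w := by
  refine ⟨f (1, 0, 0), f (0, 1, 0), f (0, 0, 1), ?_⟩
  refine LinearMap.ext fun ⟨a, b, c⟩ => ?_
  have e : ((a, b, c) : S × S × S) = a • (1, 0, 0) + b • (0, 1, 0) + c • (0, 0, 1) := by simp
  rw [e, map_add, map_add, map_smul, map_smul, map_smul, ← e]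
  rfl

/-- The second differential of the Koszul complex on `x, y, z`. -/
def koszulTwo (x y z : S) : S × S × S →ₗ[S] S × S × S :=
  (linForm S (-y) (-z) 0).prod ((linForm S x 0 (-z)).prod (linForm S 0 x y))

lemma koszulTwo_apply (x y z r p q : S) :
    koszulTwo S x y z (r, p, q) =
      (r * -y + p * -z + q * 0, r * x + p * 0 + q * -z, r * 0 + p * x + q * y) := rfl

/-- The third differential of the Koszul complex on `x, y, z`. -/
def koszulThree (x y z : S) : S →ₗ[S] S × S × S :=
  LinearMap.toSpanSingleton S (S × S × S) (z, -y, x)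

lemma koszulThree_apply (x y z t : S) :
    koszulThree S x y z t = (t * z, t * -y, t * x) := rfl

/-- The terms of the free resolution of `S ⧸ (x², xy, xz)`. -/
def resX : ℕ → ModuleCat.{u} S
  | 0 => ModuleCat.of S S
  | 1 => ModuleCat.of S (S × S × S)
  | 2 => ModuleCat.of S (S × S × S)
  | 3 => ModuleCat.of S S
  | _ + 4 => ModuleCat.of S PUnit

instance projective_resX (n : ℕ) : Projective (resX S n) := by
  match n with
  | 0 | 3 => exact (IsProjective.iff_projective S).mp inferInstance
  | 1 | 2 => exact (IsProjective.iff_projective (S × S × S)).mp inferInstance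
  | n + 4 => exact (IsProjective.iff_projective PUnit).mp inferInstance

variable {S} (x y z : S)

/-- The differentials of the free resolution of `S ⧸ (x², xy, xz)`. -/
def resD : ∀ n, resX S (n + 1) ⟶ resX S n
  | 0 => ModuleCat.ofHom (linForm S (x ^ 2) (x * y) (x * z))
  | 1 => ModuleCat.ofHom (koszulTwo S x y z)
  | 2 => ModuleCat.ofHom (koszulThree S x y z)
  | _ + 3 => 0

lemma resD_comp_resD (n : ℕ) : resD x y z (n + 1) ≫ resD x y z n = 0 := by
  match n with
  | 0 =>
    refine ModuleCat.hom_ext (LinearMap.ext fun ((r, p, q) : S × S × S) => ?_)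
    change linForm S _ _ _ (koszulTwo S x y z (r, p, q)) = 0
    rw [koszulTwo_apply, linForm_apply]
    ring
  | 1 =>
    refine ModuleCat.hom_ext (LinearMap.ext fun (t : S) => ?_)
    change koszulTwo S x y z (koszulThree S x y z t) = 0
    rw [koszulThree_apply, koszulTwo_apply, Prod.mk_eq_zero, Prod.mk_eq_zero]
    refine ⟨?_, ?_, ?_⟩ <;> ring
  | n + 2 => exact zero_comp

/-- The complex underlying the free resolution of `S ⧸ (x², xy, xz)`. -/
noncomputable def resComplex : ChainComplex (ModuleCat.{u} S) ℕ :=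
  ChainComplex.of (resX S) (resD x y z) (resD_comp_resD x y z)

lemma resComplex_d (n : ℕ) : (resComplex x y z).d (n + 1) n = resD x y z n :=
  ChainComplex.of_d _ _ _

lemma mem_span_iff_exists_linForm (a : S) :
    a ∈ Ideal.span {x ^ 2, x * y, x * z} ↔
      ∃ v, linForm S (x ^ 2) (x * y) (x * z) v = a := by
  simp only [Ideal.mem_span_insert, Ideal.mem_span_singleton']
  constructor
  · rintro ⟨a, _, ⟨b, _, ⟨c, rfl⟩, rfl⟩, rfl⟩
    exact ⟨(a, b, c), by rw [linForm_apply]; ring⟩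
  · rintro ⟨⟨a, b, c⟩, rfl⟩
    exact ⟨a, _, ⟨b, _, ⟨c, rfl⟩, rfl⟩, by rw [linForm_apply]; ring⟩

/-- In a domain, this says that the elements `x, y, z` form a regular sequence. -/
structure IsKoszulTriple : Prop where
  ne_zero : x ≠ 0
  dvd_of_dvd_mul : ∀ b, x ∣ y * b → x ∣ b
  mem_of_mul_mem : ∀ a b c, z * c = x * a + y * b → ∃ p q, c = x * p + y * q
  sum_ne_one : ∀ a b c, a * x + b * y + c * z ≠ 1

variable {x y z} [IsDomain S] (h : IsKoszulTriple x y z)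
include h

lemma IsKoszulTriple.exists_of_linForm_eq_zero {a b c : S} (e : a * x + b * y + c * z = 0) :
    ∃ r p q, a = -(y * r) - z * p ∧ b = x * r - z * q ∧ c = x * p + y * q := by
  obtain ⟨p, q, rfl⟩ := h.mem_of_mul_mem (-a) (-b) c (by linear_combination e)
  obtain ⟨r, hr⟩ := h.dvd_of_dvd_mul (b + z * q) ⟨-(a + z * p), by linear_combination e⟩
  refine ⟨r, p, q, ?_, by linear_combination hr, rfl⟩
  refine mul_left_cancel₀ h.ne_zero ?_
  linear_combination e - y * hr

lemma IsKoszulTriple.exact_resD (n : ℕ) (v : resX S (n + 1))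
    (hv : (resD x y z n).hom v = 0) : ∃ w, (resD x y z (n + 1)).hom w = v := by
  match n with
  | 0 =>
    obtain ⟨a, b, c⟩ : S × S × S := v
    change a * x ^ 2 + b * (x * y) + c * (x * z) = 0 at hv
    obtain ⟨r, p, q, rfl, rfl, rfl⟩ := h.exists_of_linForm_eq_zero (a := a) (b := b) (c := c)
      (mul_left_cancel₀ h.ne_zero (by linear_combination hv))
    refine ⟨((r, p, q) : S × S × S), ?_⟩
    change koszulTwo S x y z (r, p, q) = _
    ext <;> simp [koszulTwo, linForm] <;> ring
  | 1 =>
    obtain ⟨r, p, q⟩ : S × S × S := v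
    have h1 : r * -y + p * -z + q * 0 = 0 := congrArg Prod.fst hv
    have h2 : r * x + p * 0 + q * -z = 0 := congrArg (fun t => t.2.1) hv
    have h3 : r * 0 + p * x + q * y = 0 := congrArg (fun t => t.2.2) hv
    obtain ⟨t, rfl⟩ := h.dvd_of_dvd_mul q ⟨-p, by linear_combination h3⟩
    obtain rfl : p = -(y * t) := mul_left_cancel₀ h.ne_zero (by linear_combination h3)
    obtain rfl : r = z * t := mul_left_cancel₀ h.ne_zero (by linear_combination h2)
    refine ⟨(t : S), ?_⟩
    change koszulThree S x y z t = _
    ext <;> simp [koszulThree] <;> ring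
  | 2 =>
    have h1 : (show S from v) * x = 0 := congrArg (fun t => t.2.2) hv
    refine ⟨PUnit.unit, ?_⟩
    exact ((mul_eq_zero.mp h1).resolve_right h.ne_zero).symm
  | n + 3 => exact ⟨PUnit.unit, rfl⟩

/-- The free resolution of `S ⧸ (x², xy, xz)`. -/
noncomputable def IsKoszulTriple.resolution :
    ProjectiveResolution (ModuleCat.of S (S ⧸ Ideal.span {x ^ 2, x * y, x * z})) where
  complex := resComplex x y z
  projective n := projective_resX S n
  π := (ChainComplex.toSingle₀Equiv _ _).symm
    ⟨ModuleCat.ofHom (Ideal.span {x ^ 2, x * y, x * z}).mkQ, by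
      rw [resComplex_d]
      refine ModuleCat.hom_ext (LinearMap.ext fun (v : S × S × S) => ?_)
      exact Ideal.Quotient.eq_zero_iff_mem.mpr
        ((mem_span_iff_exists_linForm x y z _).mpr ⟨v, rfl⟩)⟩
  quasiIso := ⟨fun n => by
    cases n with
    | zero =>
      rw [ChainComplex.quasiIsoAt₀_iff, ShortComplex.quasiIso_iff_of_zeros' _ rfl rfl rfl]
      constructor
      · rw [ShortComplex.moduleCat_exact_iff]
        intro (v : S) hv
        have hv' : Ideal.Quotient.mk (Ideal.span {x ^ 2, x * y, x * z}) v = 0 := hv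
        obtain ⟨w, hw⟩ := (mem_span_iff_exists_linForm x y z _).mp
          (Ideal.Quotient.eq_zero_iff_mem.mp hv')
        refine ⟨w, ?_⟩
        change ((resComplex x y z).d 1 0).hom w = v
        rw [resComplex_d]
        exact hw
      · rw [ModuleCat.epi_iff_surjective]
        exact Submodule.mkQ_surjective (Ideal.span {x ^ 2, x * y, x * z})
    | succ n =>
      rw [quasiIsoAt_iff_exactAt' (hL := ChainComplex.exactAt_succ_single_obj ..),
        HomologicalComplex.exactAt_iff' _ (n + 2) (n + 1) n (by simp) (by simp),
        ShortComplex.moduleCat_exact_iff]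
      intro v hv
      change ((resComplex x y z).d (n + 1) n).hom v = 0 at hv
      change ∃ w, ((resComplex x y z).d (n + 2) (n + 1)).hom w = v
      rw [resComplex_d] at hv ⊢
      exact h.exact_resD n v hv⟩

end KoszulType

lemma CategoryTheory.ProjectiveResolution.subsingleton_ext_succ_iff {R : Type u} [CommRing R]
    {M : ModuleCat.{u} R} (P : ProjectiveResolution M) (n : ℕ) (Y : ModuleCat.{u} R) :
    Subsingleton (((Ext R (ModuleCat.{u} R) (n + 1)).obj (Opposite.op M)).obj Y) ↔
      ∀ f : P.complex.X (n + 1) ⟶ Y, P.complex.d (n + 2) (n + 1) ≫ f = 0 →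
        ∃ g, P.complex.d (n + 1) n ≫ g = f := by
  rw [← ModuleCat.isZero_iff_subsingleton, (P.isoExt (n + 1) Y).isZero_iff,
    ← HomologicalComplex.exactAt_iff_isZero_homology,
    HomologicalComplex.exactAt_iff' _ n (n + 1) (n + 2) (by simp) (by simp),
    ShortComplex.moduleCat_exact_iff]
  rfl

lemma CategoryTheory.ProjectiveResolution.subsingleton_ext_zero {R : Type u} [CommRing R]
    {M : ModuleCat.{u} R} (P : ProjectiveResolution M) (Y : ModuleCat.{u} R)
    (hY : ∀ f : P.complex.X 0 ⟶ Y, P.complex.d 1 0 ≫ f = 0 → f = 0) :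
    Subsingleton (((Ext R (ModuleCat.{u} R) 0).obj (Opposite.op M)).obj Y) := by
  rw [← ModuleCat.isZero_iff_subsingleton, (P.isoExt 0 Y).isZero_iff,
    ← HomologicalComplex.exactAt_iff_isZero_homology,
    HomologicalComplex.exactAt_iff' _ 0 0 1 (by simp) (by simp),
    ShortComplex.moduleCat_exact_iff]
  intro f hf
  exact ⟨0, (map_zero _).trans (hY f hf).symm⟩

section KoszulType

variable {S : Type u} [CommRing S] [IsDomain S] {x y z : S} (h : IsKoszulTriple x y z)
include h

lemma IsKoszulTriple.subsingleton_ext_succ_iff (n : ℕ) (Y : ModuleCat.{u} S) :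
    Subsingleton (((Ext S (ModuleCat.{u} S) (n + 1)).obj (Opposite.op
      (ModuleCat.of S (S ⧸ Ideal.span {x ^ 2, x * y, x * z})))).obj Y) ↔
      ∀ f : resX S (n + 1) ⟶ Y, resD x y z (n + 1) ≫ f = 0 →
        ∃ g, resD x y z n ≫ g = f := by
  rw [h.resolution.subsingleton_ext_succ_iff]
  change (∀ f : resX S (n + 1) ⟶ Y, (resComplex x y z).d _ _ ≫ f = 0 →
    ∃ g, (resComplex x y z).d _ _ ≫ g = f) ↔ _
  rw [resComplex_d, resComplex_d]
  rfl

lemma IsKoszulTriple.subsingleton_ext_of_three_lt {i : ℕ} (hi : 3 < i) (Y : ModuleCat.{u} S) :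
    Subsingleton (((Ext S (ModuleCat.{u} S) i).obj (Opposite.op
      (ModuleCat.of S (S ⧸ Ideal.span {x ^ 2, x * y, x * z})))).obj Y) := by
  obtain ⟨n, rfl⟩ := Nat.exists_eq_add_of_le' hi
  refine (h.subsingleton_ext_succ_iff (n + 3) Y).mpr fun f _ => ⟨0, ?_⟩
  refine ModuleCat.hom_ext (LinearMap.ext fun v => ?_)
  obtain rfl : v = 0 := rfl
  exact (map_zero _).trans (map_zero _).symm

lemma IsKoszulTriple.subsingleton_extMod_zero :
    Subsingleton (extMod S 0 (S ⧸ Ideal.span {x ^ 2, x * y, x * z}) S) := by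
  refine h.resolution.subsingleton_ext_zero _ fun f hf => ?_
  change (resComplex x y z).d 1 0 ≫ (show resX S 0 ⟶ ModuleCat.of S S from f) = 0 at hf
  rw [resComplex_d] at hf
  let f' : S →ₗ[S] S := ModuleCat.Hom.hom f
  have e : f' (linForm S (x ^ 2) (x * y) (x * z) (1, 0, 0)) = 0 :=
    congrArg (fun g => g.hom ((1, 0, 0) : S × S × S)) hf
  rw [← mul_one (linForm S _ _ _ _), ← smul_eq_mul, map_smul, linForm_apply, smul_eq_mul] at e
  have e1 : f' 1 = 0 := mul_left_cancel₀ (pow_ne_zero 2 h.ne_zero) (by linear_combination e)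
  have e2 : f' = 0 := LinearMap.ext_ring e1
  exact ModuleCat.hom_ext e2

lemma IsKoszulTriple.not_subsingleton_extMod_one :
    ¬ Subsingleton (extMod S 1 (S ⧸ Ideal.span {x ^ 2, x * y, x * z}) S) := by
  intro h1
  obtain ⟨g, hg⟩ := (h.subsingleton_ext_succ_iff 0 _).mp h1
    (ModuleCat.ofHom (linForm S x y z)) (by
      refine ModuleCat.hom_ext (LinearMap.ext fun ((r, p, q) : S × S × S) => ?_)
      change linForm S x y z (koszulTwo S x y z (r, p, q)) = 0
      rw [koszulTwo_apply, linForm_apply]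
      ring)
  let g' : S →ₗ[S] S := g.hom
  have e : g' (linForm S (x ^ 2) (x * y) (x * z) (1, 0, 0)) = linForm S x y z (1, 0, 0) :=
    congrArg (fun g => g.hom ((1, 0, 0) : S × S × S)) hg
  rw [← mul_one (linForm S _ _ _ _), ← smul_eq_mul, map_smul, linForm_apply, linForm_apply,
    smul_eq_mul] at e
  refine h.sum_ne_one (g' 1) 0 0 (mul_left_cancel₀ h.ne_zero ?_)
  linear_combination e

lemma IsKoszulTriple.subsingleton_extMod_two :
    Subsingleton (extMod S 2 (S ⧸ Ideal.span {x ^ 2, x * y, x * z}) S) := by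
  refine (h.subsingleton_ext_succ_iff 1 _).mpr fun f hf => ?_
  obtain ⟨u, v, w, e⟩ := exists_eq_linForm S (show S × S × S →ₗ[S] S from f.hom)
  have hf1 : (show S × S × S →ₗ[S] S from f.hom) (koszulThree S x y z 1) = 0 :=
    congrArg (fun g => g.hom (1 : S)) hf
  rw [e, koszulThree_apply, linForm_apply] at hf1
  obtain ⟨r, p, q, rfl, hv, rfl⟩ := h.exists_of_linForm_eq_zero (a := w) (b := -v) (c := u)
    (by linear_combination hf1)
  refine ⟨ModuleCat.ofHom (linForm S (-q) p (-r)), ?_⟩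
  refine ModuleCat.hom_ext (LinearMap.ext fun ((a, b, c) : S × S × S) => ?_)
  refine Eq.trans ?_ (LinearMap.congr_fun e (a, b, c)).symm
  change linForm S _ _ _ (koszulTwo S x y z (a, b, c)) = _
  rw [koszulTwo_apply, linForm_apply, linForm_apply]
  linear_combination b * hv

lemma IsKoszulTriple.not_subsingleton_extMod_three :
    ¬ Subsingleton (extMod S 3 (S ⧸ Ideal.span {x ^ 2, x * y, x * z}) S) := by
  intro h3
  obtain ⟨g, hg⟩ := (h.subsingleton_ext_succ_iff 2 _).mp h3 (𝟙 (ModuleCat.of S S)) zero_comp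
  obtain ⟨u, v, w, e⟩ := exists_eq_linForm S (show S × S × S →ₗ[S] S from g.hom)
  have hg1 : (show S × S × S →ₗ[S] S from g.hom) (koszulThree S x y z 1) = 1 :=
    congrArg (fun g => g.hom (1 : S)) hg
  rw [e, koszulThree_apply, linForm_apply] at hg1
  exact h.sum_ne_one w (-v) u (by linear_combination hg1)

lemma IsKoszulTriple.projDim_eq_three :
    projDim S (S ⧸ Ideal.span {x ^ 2, x * y, x * z}) = 3 := by
  refine le_antisymm (sInf_le fun i hi Y => ?_) (le_sInf fun n hn => ?_)
  · exact h.subsingleton_ext_of_three_lt (by exact_mod_cast hi) Y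
  · by_contra! hlt
    exact h.not_subsingleton_extMod_three (hn 3 (by exact_mod_cast hlt) _)

lemma IsKoszulTriple.moduleGrade_eq_one :
    moduleGrade S (S ⧸ Ideal.span {x ^ 2, x * y, x * z}) = 1 := by
  refine le_antisymm (Nat.sInf_le h.not_subsingleton_extMod_one) ?_
  refine le_csInf ⟨1, h.not_subsingleton_extMod_one⟩ fun n hn => Nat.one_le_iff_ne_zero.mpr ?_
  rintro rfl
  exact hn h.subsingleton_extMod_zero

end KoszulType

section PowerSeries

open MvPowerSeries

variable {σ R : Type*} [CommRing R]

lemma MvPowerSeries.X_dvd_of_X_dvd_X_mul {s t : σ} (hst : s ≠ t) {b : MvPowerSeries σ R}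
    (hb : (X s : MvPowerSeries σ R) ∣ X t * b) : (X s : MvPowerSeries σ R) ∣ b := by
  rw [X_dvd_iff] at hb ⊢
  intro m hm
  have := hb (Finsupp.single t 1 + m) (by simp [hm, hst])
  rwa [X_def, coeff_add_monomial_mul, one_mul] at this

lemma MvPowerSeries.exists_eq_X_mul_add_X_mul {s t : σ} {c : MvPowerSeries σ R}
    (hc : ∀ m : σ →₀ ℕ, m s = 0 → m t = 0 → coeff m c = 0) :
    ∃ p q, c = X s * p + X t * q := by
  classical
  let f : MvPowerSeries σ R := fun m => if m s = 0 then 0 else coeff m c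
  have hf (m) : coeff m f = if m s = 0 then 0 else coeff m c := rfl
  obtain ⟨p, hp⟩ : (X s : MvPowerSeries σ R) ∣ f := X_dvd_iff.mpr fun m hm => by simp [hf, hm]
  obtain ⟨q, hq⟩ : (X t : MvPowerSeries σ R) ∣ c - f := X_dvd_iff.mpr fun m hm => by
    by_cases hs : m s = 0 <;> simp [hf, hs, hc m, hm]
  exact ⟨p, q, by linear_combination hp + hq⟩

lemma MvPowerSeries.exists_of_X_mul_eq {s t r : σ} (hs : s ≠ r) (ht : t ≠ r)
    {a b c : MvPowerSeries σ R} (e : X r * c = X s * a + X t * b) :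
    ∃ p q, c = X s * p + X t * q := by
  refine exists_eq_X_mul_add_X_mul fun m hms hmt => ?_
  have h1 := X_dvd_iff.mp (Dvd.intro a rfl : (X s : MvPowerSeries σ R) ∣ X s * a)
    (Finsupp.single r 1 + m) (by simp [hms, hs])
  have h2 := X_dvd_iff.mp (Dvd.intro b rfl : (X t : MvPowerSeries σ R) ∣ X t * b)
    (Finsupp.single r 1 + m) (by simp [hmt, ht])
  have h3 := congrArg (coeff (Finsupp.single r 1 + m)) e
  rwa [map_add, h1, h2, X_def, coeff_add_monomial_mul, one_mul, add_zero] at h3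

lemma isKoszulTriple_X (k : Type u) [Field k] :
    IsKoszulTriple (X 0 : MvPowerSeries (Fin 3) k) (X 1) (X 2) where
  ne_zero h := by
    have := congrArg (coeff (Finsupp.single 0 1)) h
    simp at this
  dvd_of_dvd_mul _ := X_dvd_of_X_dvd_X_mul (by decide)
  mem_of_mul_mem _ _ _ := exists_of_X_mul_eq (by decide) (by decide)
  sum_ne_one a b c h := by
    have := congrArg constantCoeff h
    simp at this

end PowerSeries

/-- For `Q = k[[x, y, z]]` and `M = Q/(x², xy, xz)`: `pd_Q M = 3`, `grade M = 1`,
`Ext_Q^2(M, Q) = 0`, and `Ext_Q^1(M, Q) ≠ 0`; so Ext rigidity up to the projective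
dimension fails for this non-Cohen–Macaulay module. -/
theorem ext_rigidity_fails_without_CM (k : Type u) [Field k] :
    projDim (MvPowerSeries (Fin 3) k) (MvPowerSeries (Fin 3) k ⧸ exIdeal k) = (3 : ℕ∞) ∧
    moduleGrade (MvPowerSeries (Fin 3) k) (MvPowerSeries (Fin 3) k ⧸ exIdeal k) = 1 ∧
    Subsingleton (extMod (MvPowerSeries (Fin 3) k) 2
      (MvPowerSeries (Fin 3) k ⧸ exIdeal k) (MvPowerSeries (Fin 3) k)) ∧
    ¬ Subsingleton (extMod (MvPowerSeries (Fin 3) k) 1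
      (MvPowerSeries (Fin 3) k ⧸ exIdeal k) (MvPowerSeries (Fin 3) k)) :=
  have : IsDomain (MvPowerSeries (Fin 3) k) := NoZeroDivisors.to_isDomain _
  have h := isKoszulTriple_X k
  ⟨h.projDim_eq_three, h.moduleGrade_eq_one, h.subsingleton_extMod_two,
    h.not_subsingleton_extMod_one⟩
end
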